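/- For every real number α with 1 < α ≤ 6/5, the α-Cauchy distribution is infinitely divisible. -/

import Mathlib

open MeasureTheory Real

/-- The `n`-fold convolution power of a measure on `ℝ`. -/
noncomputable def convPow (ν : Measure ℝ) : ℕ → Measure ℝ
  | 0 => Measure.dirac 0
  | n + 1 => (convPow ν n).conv ν

/-- A probability measure on `ℝ` is infinitely divisible if for every positive integer `n`
it is the `n`-fold convolution of some probability measure with itself. -/
def IsInfinitelyDivisible (μ : Measure ℝ) : Prop :=
  ∀ n : ℕ, 0 < n → ∃ ν : Measure ℝ, IsProbabilityMeasure ν ∧ μ = convPow ν n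

/-- The `α`-Cauchy distribution: density `α·sin(π/α)/(2π) · (1+|t|^α)⁻¹` w.r.t. Lebesgue. -/
noncomputable def alphaCauchy (α : ℝ) : Measure ℝ :=
  volume.withDensity fun t => ENNReal.ofReal (α * Real.sin (π / α) / (2 * π) * (1 + |t| ^ α)⁻¹)

open scoped FourierTransform ENNReal

theorem charFun_withDensity_ofReal {k : ℝ → ℝ} (hk : Measurable k) (hk0 : ∀ x, 0 ≤ k x) (t : ℝ) :
    charFun (volume.withDensity fun x => ENNReal.ofReal (k x)) t =
      ∫ x : ℝ, Complex.exp (t * x * Complex.I) * k x := by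
  rw [charFun_apply_real, integral_withDensity_eq_integral_toReal_smul (by fun_prop) (by simp)]
  refine integral_congr_ae (.of_forall fun x => ?_)
  simp [ENNReal.toReal_ofReal (hk0 x), mul_comm]

/-- The triangular function, supported on `[-1, 1]`. -/
noncomputable def triangle (x : ℝ) : ℝ := max 0 (1 - |x|)

theorem triangle_of_one_le {x : ℝ} (hx : 1 ≤ |x|) : triangle x = 0 :=
  max_eq_left (by linarith)

theorem triangle_of_le_one {x : ℝ} (hx : |x| ≤ 1) : triangle x = 1 - |x| :=
  max_eq_right (by linarith)

theorem continuous_triangle : Continuous triangle := by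
  unfold triangle; fun_prop

theorem integral_mul_triangle {h : ℝ → ℂ} (hh : Continuous h) :
    ∫ x, h x * triangle x = ∫ x in (0 : ℝ)..1, (h x + h (-x)) * (1 - x) := by
  have hc : Continuous fun x => h x * (triangle x : ℂ) :=
    hh.mul (Complex.continuous_ofReal.comp continuous_triangle)
  have hsupp : Function.support (fun x => h x * (triangle x : ℂ)) ⊆ Set.Ioc (-1) 1 := by
    intro x hx
    by_contra hx'
    apply hx
    have : 1 ≤ |x| := by
      rw [le_abs]
      by_contra! H
      exact hx' ⟨by linarith, H.1.le⟩
    simp [triangle_of_one_le this]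
  rw [← intervalIntegral.integral_eq_integral_of_support_subset hsupp,
    ← intervalIntegral.integral_add_adjacent_intervals (b := 0) (hc.intervalIntegrable _ _)
      (hc.intervalIntegrable _ _)]
  have h1 : ∫ x in (-1 : ℝ)..0, h x * (triangle x : ℂ) =
      ∫ x in (0 : ℝ)..1, h (-x) * (triangle (-x) : ℂ) := by
    rw [intervalIntegral.integral_comp_neg (fun x => h x * (triangle x : ℂ))]; simp
  have hc' : Continuous fun x => h (-x) * (triangle (-x) : ℂ) := hc.comp continuous_neg
  rw [h1, ← intervalIntegral.integral_add (hc'.intervalIntegrable _ _) (hc.intervalIntegrable _ _)]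
  refine intervalIntegral.integral_congr fun x hx => ?_
  rw [Set.uIcc_of_le zero_le_one] at hx
  have hx1 : |x| ≤ 1 := by rw [abs_of_nonneg hx.1]; exact hx.2
  have hx2 : |-x| ≤ 1 := by rwa [abs_neg]
  simp only [triangle_of_le_one hx1, triangle_of_le_one hx2, abs_neg, abs_of_nonneg hx.1]
  push_cast
  ring

/-- The Fourier transform of the triangular function. -/
noncomputable def fejer (ξ : ℝ) : ℝ :=
  if ξ = 0 then 1 else (1 - cos (2 * π * ξ)) / (2 * (π * ξ) ^ 2)

theorem fejer_nonneg (ξ : ℝ) : 0 ≤ fejer ξ := by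
  unfold fejer
  split_ifs
  · exact zero_le_one
  · have := cos_le_one (2 * π * ξ)
    apply div_nonneg <;> [linarith; positivity]

theorem measurable_fejer : Measurable fejer := by
  unfold fejer
  exact Measurable.ite (measurableSet_singleton 0) measurable_const (by fun_prop)

theorem fejer_le (ξ : ℝ) : fejer ξ ≤ 2 * (1 + ξ ^ 2)⁻¹ := by
  unfold fejer
  split_ifs with h
  · simp [h]
  have hξ : 0 < ξ ^ 2 := by positivity
  have hπ := pi_gt_three
  rw [← div_eq_mul_inv, div_le_div_iff₀ (by positivity) (by positivity)]
  have h1 : 1 - cos (2 * π * ξ) ≤ 2 * (π * ξ) ^ 2 := by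
    have := one_sub_sq_div_two_le_cos (x := 2 * π * ξ)
    nlinarith
  have h2 : 1 - cos (2 * π * ξ) ≤ 2 := by linarith [neg_one_le_cos (2 * π * ξ)]
  have h3 : (1 : ℝ) ≤ π ^ 2 := by nlinarith
  have h4 : 2 * ξ ^ 2 ≤ 2 * (π * ξ) ^ 2 := by nlinarith
  nlinarith

theorem fourier_triangle (ξ : ℝ) : 𝓕 (fun x => (triangle x : ℂ)) ξ = fejer ξ := by
  rw [fourier_eq']
  have h0 : ∀ x : ℝ, Complex.exp (((-2 * π * inner ℝ x ξ : ℝ) : ℂ) * Complex.I) =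
      Complex.exp ((-2 * π * ξ * Complex.I) * x) := by
    intro x; congr 1; simp; ring
  simp only [h0, smul_eq_mul]
  rw [integral_mul_triangle (h := fun x => Complex.exp ((-2 * π * ξ * Complex.I) * x)) (by fun_prop)]
  by_cases hξ : ξ = 0
  · subst hξ
    have hd : ∀ x ∈ Set.uIcc (0 : ℝ) 1, HasDerivAt (fun x : ℝ => ((2 * x - x ^ 2 : ℝ) : ℂ))
        ((2 - 2 * x : ℝ) : ℂ) x := by
      intro x _
      apply HasDerivAt.ofReal_comp
      refine (((hasDerivAt_id x).const_mul 2).sub (hasDerivAt_pow 2 x)).congr_deriv ?_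
      simp
    have := intervalIntegral.integral_eq_sub_of_hasDerivAt hd
      (Continuous.intervalIntegrable (by fun_prop) _ _)
    simp only [fejer, if_true]
    calc _ = ∫ x in (0 : ℝ)..1, ((2 - 2 * x : ℝ) : ℂ) := by
          refine intervalIntegral.integral_congr fun x _ => ?_
          simp; ring
      _ = _ := by rw [this]; norm_num
  · set c : ℂ := -2 * π * ξ * Complex.I with hc
    have hc0 : c ≠ 0 := by simp [hc, hξ, pi_ne_zero]
    have hd : ∀ x ∈ Set.uIcc (0 : ℝ) 1, HasDerivAt (fun x : ℝ =>
        Complex.exp (c * x) * ((1 - x) / c + 1 / c ^ 2) +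
          Complex.exp (c * (-x : ℝ)) * (-(1 - x) / c + 1 / c ^ 2))
        ((Complex.exp (c * x) + Complex.exp (c * (-x : ℝ))) * (1 - x)) x := by
      intro x _
      have hid : HasDerivAt (fun x : ℝ => (x : ℂ)) 1 x := (hasDerivAt_id x).ofReal_comp
      have h1 : HasDerivAt (fun x : ℝ => Complex.exp (c * x)) (Complex.exp (c * x) * (c * 1)) x :=
        (hid.const_mul c).cexp
      have h2 : HasDerivAt (fun x : ℝ => Complex.exp (c * (-x : ℝ)))
          (Complex.exp (c * (-x : ℝ)) * (c * -1)) x := by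
        have : HasDerivAt (fun x : ℝ => ((-x : ℝ) : ℂ)) (-1) x := by
          simpa using (hasDerivAt_neg x).ofReal_comp
        exact (this.const_mul c).cexp
      have h3 : HasDerivAt (fun x : ℝ => (1 - (x : ℂ)) / c + 1 / c ^ 2) (-1 / c) x := by
        simpa using ((hid.const_sub 1).div_const c).add_const (1 / c ^ 2)
      have h4 : HasDerivAt (fun x : ℝ => -(1 - (x : ℂ)) / c + 1 / c ^ 2) (1 / c) x := by
        simpa using (((hid.const_sub 1).neg).div_const c).add_const (1 / c ^ 2)
      refine ((h1.mul h3).add (h2.mul h4)).congr_deriv ?_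
      field_simp
      ring
    rw [intervalIntegral.integral_eq_sub_of_hasDerivAt hd
      (Continuous.intervalIntegrable (by fun_prop) _ _)]
    simp only [fejer, hξ, if_false]
    have hcos : Complex.exp c + Complex.exp (-c) = 2 * Complex.cos (2 * π * ξ) := by
      rw [Complex.cos, hc]
      ring_nf
    have hc2 : c ^ 2 = -(4 * (π * ξ) ^ 2) := by
      rw [hc, mul_pow, Complex.I_sq]; ring
    have hπ : (π : ℂ) * ξ ≠ 0 := by simp [hξ, pi_ne_zero]
    calc _ = (Complex.exp c + Complex.exp (-c) - 2) / c ^ 2 := by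
          push_cast
          simp
          field_simp
          ring
      _ = _ := by
          rw [hcos, hc2]
          push_cast
          field_simp
          ring

/-- The triangular function is the characteristic function of a probability measure. -/
theorem exists_charFun_eq_triangle :
    ∃ κ : Measure ℝ, IsProbabilityMeasure κ ∧ ∀ t, charFun κ t = triangle t := by
  have hint : Integrable fejer := by
    refine (integrable_inv_one_add_sq.const_mul 2).mono' measurable_fejer.aestronglyMeasurable
      (.of_forall fun x => ?_)
    rw [norm_of_nonneg (fejer_nonneg x)]
    exact fejer_le x
  have hF : 𝓕 (fun x => (triangle x : ℂ)) = fun ξ => (fejer ξ : ℂ) := funext fourier_triangle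
  have hct : Continuous fun x => (triangle x : ℂ) :=
    Complex.continuous_ofReal.comp continuous_triangle
  have hti : Integrable fun x => (triangle x : ℂ) := by
    refine hct.integrable_of_hasCompactSupport (HasCompactSupport.intro (K := Set.Icc (-1) 1)
      isCompact_Icc fun x hx => ?_)
    rw [triangle_of_one_le, Complex.ofReal_zero]
    by_contra! H
    exact hx (abs_le.1 H.le)
  have hinv := hct.fourierInv_fourier_eq hti (by rw [hF]; exact hint.ofReal)
  set κ₀ : Measure ℝ := volume.withDensity fun x => ENNReal.ofReal (fejer x) with hκ₀
  have hκ : ∀ t, charFun κ₀ (2 * π * t) = triangle t := by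
    intro t
    rw [charFun_withDensity_ofReal measurable_fejer fejer_nonneg]
    have := congrFun hinv t
    rw [fourierInv_eq', hF] at this
    rw [← this]
    refine integral_congr_ae (.of_forall fun x => ?_)
    simp only [smul_eq_mul]
    congr 2
    simp
    ring
  have hfin : IsFiniteMeasure κ₀ := isFiniteMeasure_withDensity_ofReal hint.2
  have hprob : IsProbabilityMeasure κ₀ := by
    have h0 := hκ 0
    rw [mul_zero, charFun_zero, triangle_of_le_one (by simp)] at h0
    simp only [abs_zero, sub_zero, Complex.ofReal_inj] at h0
    exact ⟨by rwa [Measure.real, ENNReal.toReal_eq_one_iff] at h0⟩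
  refine ⟨κ₀.map (fun x => 2 * π * x), Measure.isProbabilityMeasure_map (by fun_prop), fun t => ?_⟩
  rw [charFun_map_mul, hκ]
open Filter Topology

section Polya

variable {g g₁ g₂ : ℝ → ℝ}

theorem mul_deriv_mem_Icc_of_convex (hg : ∀ x, 0 < x → HasDerivAt g (g₁ x) x)
    (hg₁ : ∀ x, 0 < x → HasDerivAt g₁ (g₂ x) x) (hg₂ : ∀ x, 0 < x → 0 ≤ g₂ x)
    (hinf : Tendsto g atTop (𝓝 0)) {x : ℝ} (hx : 0 < x) :
    x * g₁ x ∈ Set.Icc (2 * (g x - g (x / 2))) 0 := by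
  have hmono : MonotoneOn g₁ (Set.Ioi 0) := by
    refine monotoneOn_of_deriv_nonneg (convex_Ioi 0)
      (fun y hy => (hg₁ y hy).continuousAt.continuousWithinAt) ?_ ?_ <;>
      rw [interior_Ioi] <;> intro y hy
    · exact (hg₁ y hy).differentiableAt.differentiableWithinAt
    · rw [(hg₁ y hy).deriv]; exact hg₂ y hy
  have hmvt : ∀ a b, 0 < a → a < b → ∃ c ∈ Set.Ioo a b, g b - g a = g₁ c * (b - a) := by
    intro a b ha hab
    obtain ⟨c, hc, h⟩ := exists_hasDerivAt_eq_slope g g₁ hab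
      (fun y hy => (hg y (ha.trans_le hy.1)).continuousAt.continuousWithinAt)
      (fun y hy => hg y (ha.trans hy.1))
    refine ⟨c, hc, ?_⟩
    rw [h, div_mul_cancel₀ _ (by linarith)]
  constructor
  · obtain ⟨c, hc, h⟩ := hmvt (x / 2) x (by linarith) (by linarith)
    have : g₁ c ≤ g₁ x := hmono (show 0 < c by linarith [hc.1]) hx hc.2.le
    rw [h]
    nlinarith
  · refine mul_nonpos_of_nonneg_of_nonpos hx.le ?_
    by_contra! hpos
    have hlim : Tendsto (fun y => g x + g₁ x * (y - x)) atTop atTop :=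
      tendsto_atTop_add_const_left _ _
        ((tendsto_atTop_add_const_right _ (-x) tendsto_id).const_mul_atTop hpos)
    refine not_tendsto_nhds_of_tendsto_atTop (tendsto_atTop_mono' _ ?_ hlim) 0 hinf
    filter_upwards [eventually_gt_atTop x] with y hy
    obtain ⟨c, hc, h⟩ := hmvt x y hx hy
    have : g₁ x ≤ g₁ c := hmono hx (hx.trans hc.1) hc.1.le
    nlinarith

theorem tendsto_mul_deriv_atTop_of_convex (hg : ∀ x, 0 < x → HasDerivAt g (g₁ x) x)
    (hg₁ : ∀ x, 0 < x → HasDerivAt g₁ (g₂ x) x) (hg₂ : ∀ x, 0 < x → 0 ≤ g₂ x)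
    (hinf : Tendsto g atTop (𝓝 0)) : Tendsto (fun x => x * g₁ x) atTop (𝓝 0) := by
  have hl : Tendsto (fun x => 2 * (g x - g (x / 2))) atTop (𝓝 0) := by
    simpa using (hinf.sub (hinf.comp (tendsto_id.atTop_div_const (zero_lt_two' ℝ)))).const_mul 2
  refine tendsto_of_tendsto_of_tendsto_of_le_of_le' hl tendsto_const_nhds ?_ ?_ <;>
    filter_upwards [eventually_gt_atTop 0] with x hx
  · exact (mul_deriv_mem_Icc_of_convex hg hg₁ hg₂ hinf hx).1
  · exact (mul_deriv_mem_Icc_of_convex hg hg₁ hg₂ hinf hx).2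

theorem tendsto_mul_deriv_zero_of_convex (hg : ∀ x, 0 < x → HasDerivAt g (g₁ x) x)
    (hg₁ : ∀ x, 0 < x → HasDerivAt g₁ (g₂ x) x) (hg₂ : ∀ x, 0 < x → 0 ≤ g₂ x) {l : ℝ}
    (h0 : Tendsto g (𝓝[>] 0) (𝓝 l)) (hinf : Tendsto g atTop (𝓝 0)) :
    Tendsto (fun x => x * g₁ x) (𝓝[>] 0) (𝓝 0) := by
  have hhalf : Tendsto (fun x : ℝ => x / 2) (𝓝[>] 0) (𝓝[>] 0) := by
    refine tendsto_nhdsWithin_iff.2 ⟨?_, ?_⟩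
    · have : Tendsto (fun x : ℝ => x / 2) (𝓝 0) (𝓝 (0 / 2)) := tendsto_id.div_const 2
      rw [zero_div] at this
      exact this.mono_left nhdsWithin_le_nhds
    · filter_upwards [self_mem_nhdsWithin] with x hx
      exact half_pos (Set.mem_Ioi.1 hx)
  have hl : Tendsto (fun x => 2 * (g x - g (x / 2))) (𝓝[>] 0) (𝓝 0) := by
    simpa using (h0.sub (h0.comp hhalf)).const_mul 2
  refine tendsto_of_tendsto_of_tendsto_of_le_of_le' hl tendsto_const_nhds ?_ ?_ <;>
    filter_upwards [self_mem_nhdsWithin] with x hx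
  · exact (mul_deriv_mem_Icc_of_convex hg hg₁ hg₂ hinf hx).1
  · exact (mul_deriv_mem_Icc_of_convex hg hg₁ hg₂ hinf hx).2

theorem tendsto_sub_mul_deriv_sub_atTop (hg : ∀ x, 0 < x → HasDerivAt g (g₁ x) x)
    (hg₁ : ∀ x, 0 < x → HasDerivAt g₁ (g₂ x) x) (hg₂ : ∀ x, 0 < x → 0 ≤ g₂ x)
    (hinf : Tendsto g atTop (𝓝 0)) (x : ℝ) :
    Tendsto (fun a => (a - x) * g₁ a - g a) atTop (𝓝 0) := by
  have h := tendsto_mul_deriv_atTop_of_convex hg hg₁ hg₂ hinf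
  have h' : Tendsto g₁ atTop (𝓝 0) := by
    have := tendsto_inv_atTop_zero.mul h
    rw [mul_zero] at this
    refine this.congr' ?_
    filter_upwards [eventually_gt_atTop 0] with a ha
    field_simp
  have := (h.sub (h'.const_mul x)).sub hinf
  simp only [mul_zero, sub_zero] at this
  exact this.congr fun a => by ring

theorem hasDerivAt_sub_mul_deriv_sub (hg : ∀ x, 0 < x → HasDerivAt g (g₁ x) x)
    (hg₁ : ∀ x, 0 < x → HasDerivAt g₁ (g₂ x) x) (x : ℝ) {a : ℝ} (ha : 0 < a) :
    HasDerivAt (fun a => (a - x) * g₁ a - g a) ((a - x) * g₂ a) a :=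
  ((((hasDerivAt_id a).sub_const x).mul (hg₁ a ha)).sub (hg a ha)).congr_deriv (by simp)

theorem integral_Ioi_sub_mul_deriv₂ (hg : ∀ x, 0 < x → HasDerivAt g (g₁ x) x)
    (hg₁ : ∀ x, 0 < x → HasDerivAt g₁ (g₂ x) x) (hg₂ : ∀ x, 0 < x → 0 ≤ g₂ x)
    (hinf : Tendsto g atTop (𝓝 0)) {x : ℝ} (hx : 0 < x) :
    ∫ a in Set.Ioi x, (a - x) * g₂ a = g x := by
  rw [integral_Ioi_of_hasDerivAt_of_nonneg'
    (fun a ha => hasDerivAt_sub_mul_deriv_sub hg hg₁ x (hx.trans_le ha))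
    (fun a ha => mul_nonneg (sub_nonneg.2 ha.out.le) (hg₂ a (hx.trans ha)))
    (tendsto_sub_mul_deriv_sub_atTop hg hg₁ hg₂ hinf x)]
  ring

theorem integrableOn_integral_Ioi_mul_deriv₂ (hg : ∀ x, 0 < x → HasDerivAt g (g₁ x) x)
    (hg₁ : ∀ x, 0 < x → HasDerivAt g₁ (g₂ x) x) (hg₂ : ∀ x, 0 < x → 0 ≤ g₂ x) {l : ℝ}
    (h0 : Tendsto g (𝓝[>] 0) (𝓝 l)) (hinf : Tendsto g atTop (𝓝 0)) :
    IntegrableOn (fun a => a * g₂ a) (Set.Ioi 0) ∧ ∫ a in Set.Ioi 0, a * g₂ a = l := by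
  set G : ℝ → ℝ := Function.update (fun a => (a - 0) * g₁ a - g a) 0 (-l) with hG
  have hGe : ∀ a, 0 < a → G =ᶠ[𝓝 a] fun a => (a - 0) * g₁ a - g a := by
    intro a ha
    filter_upwards [lt_mem_nhds ha] with b hb
    simp [hG, hb.ne']
  have hc : ContinuousWithinAt G (Set.Ici 0) 0 := by
    rw [hG, continuousWithinAt_update_same, Set.Ici_sdiff_left]
    simpa using (tendsto_mul_deriv_zero_of_convex hg hg₁ hg₂ h0 hinf).sub h0
  have hd : ∀ a ∈ Set.Ioi (0 : ℝ), HasDerivAt G (a * g₂ a) a := by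
    intro a ha
    refine HasDerivAt.congr_of_eventuallyEq ?_ (hGe a ha)
    simpa only [sub_zero] using hasDerivAt_sub_mul_deriv_sub hg hg₁ 0 ha
  have hpos : ∀ a ∈ Set.Ioi (0 : ℝ), 0 ≤ a * g₂ a := fun a ha => mul_nonneg ha.out.le (hg₂ a ha)
  have hlim : Tendsto G atTop (𝓝 0) := by
    refine (tendsto_sub_mul_deriv_sub_atTop hg hg₁ hg₂ hinf 0).congr' ?_
    filter_upwards [eventually_gt_atTop 0] with a ha
    exact (hGe a ha).self_of_nhds.symm
  refine ⟨integrableOn_Ioi_deriv_of_nonneg hc hd hpos hlim, ?_⟩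
  rw [integral_Ioi_of_hasDerivAt_of_nonneg hc hd hpos hlim]
  simp [hG]

/-- **Pólya's criterion**, for functions twice differentiable on the positive half-line. -/
theorem exists_charFun_eq_of_convex (hg : ∀ x, 0 < x → HasDerivAt g (g₁ x) x)
    (hg₁ : ∀ x, 0 < x → HasDerivAt g₁ (g₂ x) x) (hg₂ : ∀ x, 0 < x → 0 ≤ g₂ x)
    (h0 : Tendsto g (𝓝[>] 0) (𝓝 1)) (hinf : Tendsto g atTop (𝓝 0)) :
    ∃ ν : Measure ℝ, IsProbabilityMeasure ν ∧ ∀ t, t ≠ 0 → charFun ν t = g |t| := by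
  obtain ⟨κ, hκ, hκt⟩ := exists_charFun_eq_triangle
  set k : ℝ → ℝ := (Set.Ioi 0).indicator fun a => a * deriv g₁ a with hk
  have hkpos : ∀ a, 0 < a → k a = a * g₂ a := fun a ha => by
    rw [hk, Set.indicator_of_mem (Set.mem_Ioi.2 ha), (hg₁ a ha).deriv]
  have hkm : Measurable k :=
    (measurable_id.mul (measurable_deriv g₁)).indicator measurableSet_Ioi
  have hkneg : ∀ a, a ≤ 0 → k a = 0 := fun a ha =>
    Set.indicator_of_notMem (by simpa using ha) _
  have hk0 : ∀ a, 0 ≤ k a := by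
    intro a
    rcases le_or_gt a 0 with ha | ha
    · exact (hkneg a ha).ge
    · rw [hkpos a ha]; exact mul_nonneg ha.le (hg₂ a ha)
  obtain ⟨hint, hval⟩ := integrableOn_integral_Ioi_mul_deriv₂ hg hg₁ hg₂ h0 hinf
  have hkeq : k = (Set.Ioi 0).indicator fun a => a * g₂ a := by
    funext a
    rcases le_or_gt a 0 with ha | ha
    · rw [hkneg a ha, Set.indicator_of_notMem (by simpa using ha)]
    · rw [hkpos a ha, Set.indicator_of_mem (Set.mem_Ioi.2 ha)]
  have hki : Integrable k := by
    rw [hkeq]; exact hint.integrable_indicator measurableSet_Ioi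
  set ρ : Measure ℝ := volume.withDensity fun a => ENNReal.ofReal (k a) with hρ
  have hρp : IsProbabilityMeasure ρ := by
    refine ⟨?_⟩
    rw [hρ, withDensity_apply _ MeasurableSet.univ, Measure.restrict_univ,
      ← ofReal_integral_eq_lintegral_ofReal hki (.of_forall hk0), hkeq,
      integral_indicator measurableSet_Ioi, hval, ENNReal.ofReal_one]
  have hmeas : Measurable fun p : ℝ × ℝ => p.1⁻¹ * p.2 := by fun_prop
  refine ⟨(ρ.prod κ).map fun p => p.1⁻¹ * p.2, Measure.isProbabilityMeasure_map hmeas.aemeasurable,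
    fun t ht => ?_⟩
  have hci : Integrable (fun p : ℝ × ℝ => Complex.exp (t * (p.1⁻¹ * p.2 : ℝ) * Complex.I))
      (ρ.prod κ) := by
    refine Integrable.of_bound (C := 1) (by fun_prop) (.of_forall fun p => ?_)
    rw [← Complex.ofReal_mul, Complex.norm_exp_ofReal_mul_I]
  rw [charFun_apply_real, integral_map hmeas.aemeasurable (by fun_prop), integral_prod _ hci]
  have hinner : ∀ a : ℝ, ∫ y, Complex.exp (t * (a⁻¹ * y : ℝ) * Complex.I) ∂κ =
      triangle (t * a⁻¹) := by
    intro a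
    rw [← hκt, charFun_apply_real]
    congr 1; ext y; congr 1; push_cast; ring
  simp only [hinner]
  rw [integral_complex_ofReal]
  congr 1
  rw [hρ, integral_withDensity_eq_integral_toReal_smul (by fun_prop) (by simp),
    ← integral_Ioi_sub_mul_deriv₂ hg hg₁ hg₂ hinf (abs_pos.2 ht),
    ← integral_indicator measurableSet_Ioi]
  congr 1
  ext a
  rw [ENNReal.toReal_ofReal (hk0 a), smul_eq_mul]
  rcases le_or_gt a 0 with ha | ha
  · rw [hkneg a ha, zero_mul, Set.indicator_of_notMem]
    simpa using ha.trans (abs_nonneg t)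
  have habs : |t * a⁻¹| = |t| / a := by rw [abs_mul, abs_inv, abs_of_pos ha, div_eq_mul_inv]
  rcases le_or_gt a |t| with hat | hat
  · rw [Set.indicator_of_notMem (by simpa using hat), triangle_of_one_le, mul_zero]
    rwa [habs, one_le_div ha]
  · rw [Set.indicator_of_mem (Set.mem_Ioi.2 hat), hkpos a ha, triangle_of_le_one, habs]
    · field_simp
    · rw [habs, div_le_one ha]; exact hat.le

end Polya

section LaplaceTransform

open ProbabilityTheory

theorem norm_exp_neg_mul_le_one {Ω : Type*} {X : Ω → ℝ} (hX0 : ∀ ω, 0 < X ω) {s : ℝ}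
    (hs : 0 ≤ s) (ω : Ω) :
    ‖exp (-s * X ω)‖ ≤ 1 := by
  rw [norm_of_nonneg (exp_pos _).le, exp_le_one_iff]
  nlinarith [hX0 ω]

variable {Ω : Type*} [MeasurableSpace Ω] {P : Measure Ω} [IsProbabilityMeasure P] {X : Ω → ℝ}

theorem neg_mem_interior_integrableExpSet (hX : Measurable X) (hX0 : ∀ ω, 0 < X ω) {s : ℝ}
    (hs : 0 < s) : -s ∈ interior (integrableExpSet X P) := by
  refine interior_maximal (t := Set.Iio 0) (fun t ht => ?_) isOpen_Iio (by simpa using hs)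
  refine Integrable.of_bound (C := 1) (by fun_prop) (.of_forall fun ω => ?_)
  rw [norm_of_nonneg (exp_pos _).le, exp_le_one_iff]
  exact mul_nonpos_of_nonpos_of_nonneg (le_of_lt ht) (hX0 ω).le

theorem tendsto_mgf_neg_zero (hX : Measurable X) (hX0 : ∀ ω, 0 < X ω) :
    Tendsto (fun s => mgf X P (-s)) (𝓝[>] 0) (𝓝 1) := by
  have h1 : (1 : ℝ) = ∫ _, (1 : ℝ) ∂P := by simp
  rw [h1]
  refine tendsto_integral_filter_of_dominated_convergence (fun _ => 1)
    (.of_forall fun s => by fun_prop) ?_ (integrable_const 1) (.of_forall fun ω => ?_)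
  · filter_upwards [self_mem_nhdsWithin] with s hs
    exact .of_forall (norm_exp_neg_mul_le_one hX0 (le_of_lt hs))
  · have : Continuous fun s : ℝ => exp (-s * X ω) := by fun_prop
    simpa using (this.tendsto 0).mono_left nhdsWithin_le_nhds

theorem tendsto_mgf_neg_atTop (hX : Measurable X) (hX0 : ∀ ω, 0 < X ω) :
    Tendsto (fun s => mgf X P (-s)) atTop (𝓝 0) := by
  have h1 : (0 : ℝ) = ∫ _, (0 : ℝ) ∂P := by simp
  rw [h1]
  refine tendsto_integral_filter_of_dominated_convergence (fun _ => 1)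
    (.of_forall fun s => by fun_prop) ?_ (integrable_const 1) (.of_forall fun ω => ?_)
  · filter_upwards [eventually_ge_atTop 0] with s hs
    exact .of_forall (norm_exp_neg_mul_le_one hX0 hs)
  · refine tendsto_exp_atBot.comp ?_
    exact tendsto_neg_atTop_atBot.atBot_mul_const (hX0 ω)

/-- The `n`-th roots of the Laplace transform of a positive random variable, extended to an even
function, is a characteristic function. -/
theorem exists_charFun_pow_eq_mgf (hX : Measurable X) (hX0 : ∀ ω, 0 < X ω) {n : ℕ} (hn : 0 < n) :
    ∃ ν : Measure ℝ, IsProbabilityMeasure ν ∧ ∀ t, charFun ν t ^ n = mgf X P (-|t|) := by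
  have hn' : (n : ℝ) ≠ 0 := by positivity
  have hmem {s : ℝ} (hs : 0 < s) := neg_mem_interior_integrableExpSet (P := P) hX hX0 hs
  have hexp {s : ℝ} (hs : 0 < s) : Integrable (fun ω => exp (-s * X ω)) P :=
    interior_subset (s := integrableExpSet X P) (hmem hs)
  set g : ℝ → ℝ := fun s => exp (cgf X P (-s) / n) with hgdef
  have hgpow : ∀ s, 0 < s → g s ^ n = mgf X P (-s) := by
    intro s hs
    rw [hgdef, ← exp_nat_mul, mul_div_cancel₀ _ hn', exp_cgf (hexp hs)]
  have hgrpow : ∀ s, 0 < s → mgf X P (-s) ^ (n : ℝ)⁻¹ = g s := by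
    intro s hs
    rw [← hgpow s hs, pow_rpow_inv_natCast (exp_pos _).le hn.ne']
  have hc1 : ∀ s, 0 < s →
      HasDerivAt (fun s => cgf X P (-s)) (-deriv (cgf X P) (-s)) s := by
    intro s hs
    have := (analyticAt_cgf (hmem hs)).differentiableAt.hasDerivAt
    exact (this.scomp s (hasDerivAt_neg s)).congr_deriv (by simp)
  have hc2 : ∀ s, 0 < s → HasDerivAt (fun s => -deriv (cgf X P) (-s))
      (iteratedDeriv 2 (cgf X P) (-s)) s := by
    intro s hs
    have := (analyticAt_cgf (hmem hs)).deriv.differentiableAt.hasDerivAt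
    rw [iteratedDeriv_succ, iteratedDeriv_one]
    exact (this.scomp s (hasDerivAt_neg s)).neg.congr_deriv (by simp)
  have hc3 : ∀ s, 0 < s → 0 ≤ iteratedDeriv 2 (cgf X P) (-s) := by
    intro s hs
    rw [iteratedDeriv_two_cgf_eq_integral (hmem hs)]
    exact div_nonneg (integral_nonneg fun ω => by positivity) mgf_nonneg
  have hg1 : ∀ s, 0 < s → HasDerivAt g (g s * (-deriv (cgf X P) (-s) / n)) s :=
    fun s hs => ((hc1 s hs).div_const n).exp
  have hg2 : ∀ s, 0 < s → HasDerivAt (fun s => g s * (-deriv (cgf X P) (-s) / n))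
      (g s * (-deriv (cgf X P) (-s) / n) * (-deriv (cgf X P) (-s) / n) +
        g s * (iteratedDeriv 2 (cgf X P) (-s) / n)) s :=
    fun s hs => (hg1 s hs).mul ((hc2 s hs).div_const n)
  obtain ⟨ν, hν, hνt⟩ := exists_charFun_eq_of_convex hg1 hg2
    (fun s hs => by
      have h1 := hc3 s hs
      have h2 : 0 < g s := exp_pos _
      rw [mul_assoc]
      have h3 := mul_self_nonneg (-deriv (cgf X P) (-s) / n)
      positivity)
    (by
      have := (tendsto_mgf_neg_zero (P := P) hX hX0).rpow_const (p := (n : ℝ)⁻¹) (by simp)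
      rw [one_rpow] at this
      refine this.congr' ?_
      filter_upwards [self_mem_nhdsWithin] with s hs using hgrpow s hs)
    (by
      have := (tendsto_mgf_neg_atTop (P := P) hX hX0).rpow_const (p := (n : ℝ)⁻¹)
        (Or.inr (by positivity))
      rw [zero_rpow (inv_ne_zero hn')] at this
      refine this.congr' ?_
      filter_upwards [eventually_gt_atTop 0] with s hs using hgrpow s hs)
  refine ⟨ν, hν, fun t => ?_⟩
  rcases eq_or_ne t 0 with rfl | ht
  · simp
  · rw [hνt t ht, ← hgpow _ (abs_pos.2 ht)]
    push_cast
    rfl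

theorem isProbabilityMeasure_convPow (ν : Measure ℝ) [IsProbabilityMeasure ν] (n : ℕ) :
    IsProbabilityMeasure (convPow ν n) := by
  induction n with
  | zero => unfold convPow; infer_instance
  | succ n ih => unfold convPow; infer_instance

theorem charFun_convPow (ν : Measure ℝ) [IsProbabilityMeasure ν] (n : ℕ) (t : ℝ) :
    charFun (convPow ν n) t = charFun ν t ^ n := by
  induction n with
  | zero => simp [convPow, charFun_dirac]
  | succ n ih =>
    have := isProbabilityMeasure_convPow ν n
    rw [convPow, charFun_conv, ih, pow_succ]

/-- A probability measure on `ℝ` is infinitely divisible if its characteristic function is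
`t ↦ 𝔼[exp (-|t| X)]` for a positive random variable `X`, that is, if it is a scale mixture of
Cauchy distributions. -/
theorem isInfinitelyDivisible_of_charFun_eq_mgf {μ : Measure ℝ} [IsProbabilityMeasure μ]
    (hX : Measurable X) (hX0 : ∀ ω, 0 < X ω) (h : ∀ t, charFun μ t = mgf X P (-|t|)) :
    IsInfinitelyDivisible μ := by
  intro n hn
  obtain ⟨ν, hν, hνt⟩ := exists_charFun_pow_eq_mgf (P := P) hX hX0 hn
  refine ⟨ν, hν, ?_⟩
  have := isProbabilityMeasure_convPow ν n
  refine Measure.ext_of_charFun (funext fun t => ?_)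
  rw [charFun_convPow, h, hνt]

end LaplaceTransform

section AlphaCauchy

variable {α : ℝ}

theorem lintegral_Ioi_inv_one_add_rpow (hα : 1 < α) :
    ∫⁻ t in Set.Ioi (0 : ℝ), ENNReal.ofReal ((1 + t ^ α)⁻¹) =
      ENNReal.ofReal (π / (α * sin (π / α))) := by
  have hα0 : 0 < α := by linarith
  have h1 : ∀ t ∈ Set.Ioi (0 : ℝ), ENNReal.ofReal ((1 + t ^ α)⁻¹) =
      ∫⁻ v in Set.Ioi (0 : ℝ), ENNReal.ofReal (exp (-(1 + t ^ α) * v)) := by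
    intro t ht
    have hb : 0 < 1 + t ^ α := by have := rpow_pos_of_pos ht α; linarith
    rw [← ofReal_integral_eq_lintegral_ofReal (exp_neg_integrableOn_Ioi 0 hb)
      (.of_forall fun v => (exp_pos _).le), integral_exp_mul_Ioi (by linarith)]
    congr 1
    simp [neg_div_neg_eq, -neg_add_rev]
  have h2 : ∀ v ∈ Set.Ioi (0 : ℝ),
      ∫⁻ t in Set.Ioi (0 : ℝ), ENNReal.ofReal (exp (-(1 + t ^ α) * v)) =
        ENNReal.ofReal (Gamma (1 / α + 1)) *
          ENNReal.ofReal (exp (-v) * v ^ ((1 - 1 / α) - 1)) := by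
    intro v hv
    have he : ∀ t : ℝ, exp (-(1 + t ^ α) * v) = exp (-v) * exp (-v * t ^ α) := by
      intro t; rw [← exp_add]; ring_nf
    have hint : IntegrableOn (fun t : ℝ => exp (-v * t ^ α)) (Set.Ioi 0) := by
      simpa using integrableOn_rpow_mul_exp_neg_mul_rpow (s := 0) (by norm_num) hα0 hv
    simp only [he]
    rw [← ofReal_integral_eq_lintegral_ofReal (hint.const_mul _)
      (.of_forall fun t => by positivity), integral_const_mul, integral_exp_neg_mul_rpow hα0 hv,
      ← ENNReal.ofReal_mul (Gamma_pos_of_pos (by positivity)).le]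
    congr 1
    rw [show (1 - 1 / α) - 1 = -1 / α by ring]
    ring
  have hs : 0 < 1 - 1 / α := by
    rw [sub_pos, div_lt_one hα0]; exact hα
  rw [setLIntegral_congr_fun measurableSet_Ioi h1, lintegral_lintegral_swap (by fun_prop),
    setLIntegral_congr_fun measurableSet_Ioi h2, lintegral_const_mul _ (by fun_prop),
    ← ofReal_integral_eq_lintegral_ofReal (GammaIntegral_convergent hs), ← Gamma_eq_integral hs,
    ← ENNReal.ofReal_mul (Gamma_pos_of_pos (by positivity)).le]
  · congr 1
    rw [Gamma_add_one (by positivity), mul_assoc, Gamma_mul_Gamma_one_sub]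
    field_simp
  · filter_upwards [ae_restrict_mem measurableSet_Ioi] with v hv
    have := rpow_nonneg (le_of_lt hv) ((1 - 1 / α) - 1)
    simp only [Pi.zero_apply]
    positivity

theorem sin_pi_div_pos (hα : 1 < α) : 0 < sin (π / α) :=
  sin_pos_of_pos_of_lt_pi (by positivity) (div_lt_self pi_pos hα)

theorem integrableOn_inv_one_add_rpow (hα : 1 < α) :
    IntegrableOn (fun t : ℝ => (1 + t ^ α)⁻¹) (Set.Ioi 0) := by
  refine ⟨by fun_prop, ?_⟩
  rw [hasFiniteIntegral_iff_ofReal, lintegral_Ioi_inv_one_add_rpow hα]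
  · exact ENNReal.ofReal_lt_top
  · filter_upwards [ae_restrict_mem measurableSet_Ioi] with t ht
    have := rpow_nonneg (le_of_lt ht) α
    simp only [Pi.zero_apply]
    positivity

theorem integral_Ioi_inv_one_add_rpow (hα : 1 < α) :
    ∫ t in Set.Ioi (0 : ℝ), (1 + t ^ α)⁻¹ = π / (α * sin (π / α)) := by
  have hs := sin_pi_div_pos hα
  rw [integral_eq_lintegral_of_nonneg_ae _ (integrableOn_inv_one_add_rpow hα).1,
    lintegral_Ioi_inv_one_add_rpow hα, ENNReal.toReal_ofReal (by positivity)]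
  filter_upwards [ae_restrict_mem measurableSet_Ioi] with t ht
  have := rpow_nonneg (le_of_lt ht) α
  simp only [Pi.zero_apply]
  positivity

theorem integrable_inv_one_add_abs_rpow (hα : 1 < α) :
    Integrable fun t : ℝ => (1 + |t| ^ α)⁻¹ := by
  have hpos : IntegrableOn (fun t : ℝ => (1 + |t| ^ α)⁻¹) (Set.Ioi 0) :=
    (integrableOn_inv_one_add_rpow hα).congr_fun
      (fun t ht => by simp only [abs_of_pos (Set.mem_Ioi.1 ht)]) measurableSet_Ioi
  rw [← integrableOn_univ, ← Set.Iic_union_Ioi (a := (0 : ℝ)), integrableOn_union]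
  refine ⟨?_, hpos⟩
  have hneg : MeasurableEmbedding fun x : ℝ => -x := (Homeomorph.neg ℝ).measurableEmbedding
  rw [← Measure.map_neg_eq_self (volume : Measure ℝ), hneg.integrableOn_map_iff]
  simpa [Function.comp_def, integrableOn_Ici_iff_integrableOn_Ioi] using hpos

/-- The normalising constant of the density of the `α`-Cauchy distribution. -/
noncomputable def alphaCauchyConst (α : ℝ) : ℝ := α * sin (π / α) / (2 * π)

theorem alphaCauchyConst_pos (hα : 1 < α) : 0 < alphaCauchyConst α := by
  have := sin_pi_div_pos hα
  unfold alphaCauchyConst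
  positivity

theorem alphaCauchy_density_nonneg (hα : 1 < α) (t : ℝ) :
    0 ≤ alphaCauchyConst α * (1 + |t| ^ α)⁻¹ := by
  have := alphaCauchyConst_pos hα
  positivity

theorem isProbabilityMeasure_alphaCauchy (hα : 1 < α) : IsProbabilityMeasure (alphaCauchy α) := by
  have hs := sin_pi_div_pos hα
  refine ⟨?_⟩
  rw [alphaCauchy, withDensity_apply _ MeasurableSet.univ, Measure.restrict_univ]
  change ∫⁻ t, ENNReal.ofReal (alphaCauchyConst α * (1 + |t| ^ α)⁻¹) = 1
  rw [← ofReal_integral_eq_lintegral_ofReal ((integrable_inv_one_add_abs_rpow hα).const_mul _)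
      (.of_forall (alphaCauchy_density_nonneg hα)), integral_const_mul,
    integral_comp_abs (f := fun t => (1 + t ^ α)⁻¹), integral_Ioi_inv_one_add_rpow hα,
    ENNReal.ofReal_eq_one, alphaCauchyConst]
  field_simp

theorem charFun_alphaCauchy (hα : 1 < α) (x : ℝ) :
    charFun (alphaCauchy α) x =
      (2 * alphaCauchyConst α * ∫ t in Set.Ioi 0, cos (|x| * t) * (1 + t ^ α)⁻¹ : ℝ) := by
  have hm : Measurable fun t : ℝ => alphaCauchyConst α * (1 + |t| ^ α)⁻¹ := by fun_prop
  have h0 := charFun_withDensity_ofReal hm (alphaCauchy_density_nonneg hα) x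
  set f : ℝ → ℂ := fun t => Complex.exp (x * t * Complex.I) *
    (alphaCauchyConst α * (1 + |t| ^ α)⁻¹ : ℝ) with hf
  have hfi : Integrable f := by
    refine ((integrable_inv_one_add_abs_rpow hα).const_mul (alphaCauchyConst α)).mono'
      (by fun_prop) (.of_forall fun t => ?_)
    rw [hf, norm_mul, ← Complex.ofReal_mul, Complex.norm_exp_ofReal_mul_I, one_mul,
      Complex.norm_real, norm_of_nonneg (alphaCauchy_density_nonneg hα t)]
  have hsymm : ∫ t, f t = (1 / 2 : ℂ) * ∫ t, (f t + f (-t)) := by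
    rw [integral_add hfi hfi.comp_neg, integral_neg_eq_self]
    ring
  have hcos : ∀ t, f t + f (-t) =
      (2 * (alphaCauchyConst α * (cos (|x| * |t|) * (1 + |t| ^ α)⁻¹)) : ℝ) := by
    intro t
    rw [← abs_mul, cos_abs]
    simp only [hf, abs_neg]
    rw [← add_mul]
    push_cast
    rw [Complex.cos]
    ring_nf
  calc _ = ∫ t, f t := h0
    _ = _ := by
      rw [hsymm]
      simp only [hcos]
      rw [integral_complex_ofReal, integral_const_mul, integral_const_mul,
        integral_comp_abs (f := fun t => cos (|x| * t) * (1 + t ^ α)⁻¹)]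
      push_cast
      ring

/-- The function `t ↦ exp (i x t) / (1 + t ^ α)` in the logarithmic coordinate `t = exp z`,
including the Jacobian. -/
noncomputable def logIntegrand (α x : ℝ) (z : ℂ) : ℂ :=
  Complex.exp (Complex.I * x * Complex.exp z) * Complex.exp z / (1 + Complex.exp (α * z))

theorem one_add_cos_pos (hα : 1 < α) (hα₂ : α < 2) : 0 < (1 + cos (α * (π / 2))) / 2 := by
  have hπ := pi_pos
  have : cos π < cos (α * (π / 2)) :=
    cos_lt_cos_of_nonneg_of_le_pi (by positivity) le_rfl (by nlinarith)
  rw [cos_pi] at this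
  linarith

theorem le_norm_one_add_cexp (hα : 1 < α) (hα₂ : α < 2) (y : ℝ) {φ : ℝ}
    (hφ : φ ∈ Set.Icc 0 (π / 2)) :
    (1 + cos (α * (π / 2))) / 2 * (1 + exp (α * y)) ≤
      ‖1 + Complex.exp (α * (y + φ * Complex.I))‖ := by
  have hπ := pi_pos
  set δ := (1 + cos (α * (π / 2))) / 2 with hδ
  have hδ0 : 0 < δ := one_add_cos_pos hα hα₂
  have hδ1 : δ ≤ 1 := by linarith [cos_le_one (α * (π / 2))]
  have hcos : cos (α * (π / 2)) ≤ cos (α * φ) :=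
    cos_le_cos_of_nonneg_of_le_pi (mul_nonneg (by linarith) hφ.1) (by nlinarith)
      (mul_le_mul_of_nonneg_left hφ.2 (by linarith))
  have hexp : Complex.exp (α * (y + φ * Complex.I)) =
      (exp (α * y) * cos (α * φ) : ℝ) + (exp (α * y) * sin (α * φ) : ℝ) * Complex.I := by
    rw [mul_add, Complex.exp_add, ← mul_assoc, Complex.exp_mul_I]
    push_cast
    ring
  set q := exp (α * y) with hq
  have hq0 : 0 < q := exp_pos _
  refine abs_le_of_sq_le_sq' ?_ (norm_nonneg _) |>.2
  rw [Complex.sq_norm, Complex.normSq_apply, hexp]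
  simp only [Complex.add_re, Complex.add_im, Complex.one_re, Complex.one_im, Complex.ofReal_re,
    Complex.ofReal_im, Complex.mul_re, Complex.mul_im, Complex.I_re, Complex.I_im]
  have hsc := sin_sq_add_cos_sq (α * φ)
  have h1 : (1 + q * cos (α * φ)) ^ 2 + (q * sin (α * φ)) ^ 2 =
      1 + 2 * q * cos (α * φ) + q ^ 2 := by linear_combination q ^ 2 * hsc
  have h2 : (δ * (1 + q)) ^ 2 ≤ δ * (1 + q) ^ 2 := by
    rw [mul_pow]
    exact mul_le_mul_of_nonneg_right (by nlinarith) (sq_nonneg _)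
  have h3 : δ * (1 + q) ^ 2 ≤ 1 + 2 * q * cos (α * (π / 2)) + q ^ 2 := by
    have : cos (α * (π / 2)) = 2 * δ - 1 := by linarith
    rw [this]
    nlinarith [mul_nonneg (sub_nonneg.2 hδ1) (sq_nonneg (1 - q))]
  have h4 : 2 * q * cos (α * (π / 2)) ≤ 2 * q * cos (α * φ) :=
    mul_le_mul_of_nonneg_left hcos (by positivity)
  nlinarith

theorem norm_logIntegrand_le (hα : 1 < α) (hα₂ : α < 2) {x : ℝ} (hx : 0 ≤ x) (y : ℝ) {φ : ℝ}
    (hφ : φ ∈ Set.Icc 0 (π / 2)) :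
    ‖logIntegrand α x (y + φ * Complex.I)‖ ≤
      ((1 + cos (α * (π / 2))) / 2)⁻¹ * (exp y * (1 + exp (α * y))⁻¹) := by
  have hδ := one_add_cos_pos hα hα₂
  have hle := le_norm_one_add_cexp hα hα₂ y hφ
  have h1 : ‖Complex.exp (Complex.I * x * Complex.exp (y + φ * Complex.I))‖ ≤ 1 := by
    rw [Complex.norm_exp, exp_le_one_iff]
    have : 0 ≤ sin φ := sin_nonneg_of_nonneg_of_le_pi hφ.1 (by linarith [hφ.2, pi_pos])
    have h2 : 0 ≤ x * (exp y * sin φ) := by positivity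
    simpa [Complex.exp_re, Complex.exp_im] using h2
  have h2 : ‖Complex.exp (y + φ * Complex.I)‖ = exp y := by simp [Complex.norm_exp]
  rw [logIntegrand, norm_div, norm_mul, h2]
  calc _ ≤ 1 * exp y / ((1 + cos (α * (π / 2))) / 2 * (1 + exp (α * y))) := by gcongr
    _ = _ := by rw [one_mul, div_eq_mul_inv, mul_inv]; ring

theorem hasDerivWithinAt_exp_univ (y : ℝ) : HasDerivWithinAt exp (exp y) Set.univ y :=
  (hasDerivAt_exp y).hasDerivWithinAt

theorem integrable_exp_mul_inv_one_add_exp (hα : 1 < α) :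
    Integrable fun y : ℝ => exp y * (1 + exp (α * y))⁻¹ := by
  have h := integrableOn_inv_one_add_rpow hα
  rw [← range_exp, ← Set.image_univ, integrableOn_image_iff_integrableOn_abs_deriv_smul
    MeasurableSet.univ (fun y _ => hasDerivWithinAt_exp_univ y) exp_injective.injOn,
    integrableOn_univ] at h
  refine h.congr (.of_forall fun y => ?_)
  simp only [smul_eq_mul, abs_exp]
  rw [← exp_mul, mul_comm y]

theorem tendsto_exp_mul_inv_one_add_exp_atBot :
    Tendsto (fun y : ℝ => exp y * (1 + exp (α * y))⁻¹) atBot (𝓝 0) := by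
  refine squeeze_zero (fun y => by positivity) (fun y => ?_) tendsto_exp_atBot
  refine mul_le_of_le_one_right (exp_pos _).le (inv_le_one_of_one_le₀ ?_)
  linarith [exp_pos (α * y)]

theorem tendsto_exp_mul_inv_one_add_exp_atTop (hα : 1 < α) :
    Tendsto (fun y : ℝ => exp y * (1 + exp (α * y))⁻¹) atTop (𝓝 0) := by
  have hlim : Tendsto (fun y : ℝ => exp ((1 - α) * y)) atTop (𝓝 0) :=
    tendsto_exp_atBot.comp (tendsto_id.const_mul_atTop_of_neg (by linarith))
  refine squeeze_zero (fun y => by positivity) (fun y => ?_) hlim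
  rw [show (1 - α) * y = y + -(α * y) by ring, exp_add, exp_neg]
  gcongr
  linarith

theorem integrable_logIntegrand (hα : 1 < α) (hα₂ : α < 2) {x : ℝ} (hx : 0 ≤ x) {φ : ℝ}
    (hφ : φ ∈ Set.Icc 0 (π / 2)) :
    Integrable fun y : ℝ => logIntegrand α x (y + φ * Complex.I) :=
  ((integrable_exp_mul_inv_one_add_exp hα).const_mul _).mono'
    (Measurable.aestronglyMeasurable (by
      unfold logIntegrand
      exact Measurable.div (by fun_prop) (by fun_prop)))
    (.of_forall fun y => norm_logIntegrand_le hα hα₂ hx y hφ)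

theorem tendsto_integral_logIntegrand_vertical (hα : 1 < α) (hα₂ : α < 2) {x : ℝ} (hx : 0 ≤ x)
    {l : Filter ℝ} {u : ℝ → ℝ}
    (hu : Tendsto (fun R => exp (u R) * (1 + exp (α * u R))⁻¹) l (𝓝 0)) :
    Tendsto (fun R => ∫ φ in (0 : ℝ)..π / 2, logIntegrand α x (u R + φ * Complex.I)) l (𝓝 0) := by
  have hπ := pi_pos
  refine squeeze_zero_norm (a := fun R => ((1 + cos (α * (π / 2))) / 2)⁻¹ *
    (exp (u R) * (1 + exp (α * u R))⁻¹) * |π / 2 - 0|) (fun R => ?_) ?_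
  · refine intervalIntegral.norm_integral_le_of_norm_le_const fun φ hφ => ?_
    rw [Set.uIoc_of_le (by positivity)] at hφ
    exact norm_logIntegrand_le hα hα₂ hx _ ⟨hφ.1.le, hφ.2⟩
  · simpa using (hu.const_mul ((1 + cos (α * (π / 2))) / 2)⁻¹).mul_const |π / 2 - 0|

/-- Rotation of the path of integration by a right angle. -/
theorem integral_logIntegrand_eq (hα : 1 < α) (hα₂ : α < 2) {x : ℝ} (hx : 0 ≤ x) :
    ∫ y : ℝ, logIntegrand α x y =
      ∫ y : ℝ, logIntegrand α x (y + (π / 2 : ℝ) * Complex.I) := by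
  have hπ := pi_pos
  have hδ := one_add_cos_pos hα hα₂
  have hrect : ∀ R : ℝ,
      (∫ y in (-R)..R, logIntegrand α x (y + (0 : ℝ) * Complex.I)) -
        (∫ y in (-R)..R, logIntegrand α x (y + (π / 2 : ℝ) * Complex.I)) +
        Complex.I • (∫ φ in (0 : ℝ)..π / 2, logIntegrand α x (R + φ * Complex.I)) -
        Complex.I • (∫ φ in (0 : ℝ)..π / 2, logIntegrand α x ((-R : ℝ) + φ * Complex.I)) = 0 := by
    intro R
    have := Complex.integral_boundary_rect_eq_zero_of_differentiableOn (logIntegrand α x)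
      ⟨-R, 0⟩ ⟨R, π / 2⟩ ?_
    · exact this
    · intro z hz
      have hzim : z.im ∈ Set.Icc 0 (π / 2) := by
        have := hz.2
        rwa [Set.mem_preimage, Set.uIcc_of_le (by positivity)] at this
      have hle := le_norm_one_add_cexp hα hα₂ z.re hzim
      rw [Complex.re_add_im] at hle
      have hne : 1 + Complex.exp (α * z) ≠ 0 := by
        rw [← norm_pos_iff]
        exact lt_of_lt_of_le (by positivity) hle
      have hd : DifferentiableAt ℂ (logIntegrand α x) z := by
        unfold logIntegrand
        fun_prop (disch := exact hne)
      exact hd.differentiableWithinAt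
  have h0 := intervalIntegral_tendsto_integral
    (integrable_logIntegrand hα hα₂ hx (φ := 0) ⟨le_rfl, by positivity⟩)
    tendsto_neg_atTop_atBot tendsto_id
  have h1 := intervalIntegral_tendsto_integral
    (integrable_logIntegrand hα hα₂ hx (φ := π / 2) ⟨by positivity, le_rfl⟩)
    tendsto_neg_atTop_atBot tendsto_id
  have h2 := tendsto_integral_logIntegrand_vertical hα hα₂ hx (l := atTop) (u := fun R => R)
    (tendsto_exp_mul_inv_one_add_exp_atTop hα)
  have h3 := tendsto_integral_logIntegrand_vertical hα hα₂ hx (l := atTop) (u := fun R => -R)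
    (tendsto_exp_mul_inv_one_add_exp_atBot.comp tendsto_neg_atTop_atBot)
  have hlim := ((h0.sub h1).add (h2.const_smul Complex.I)).sub (h3.const_smul Complex.I)
  simp only [id] at hlim
  have := tendsto_nhds_unique (hlim.congr hrect) tendsto_const_nhds
  simp only [smul_zero, add_zero, sub_zero, sub_eq_zero] at this
  rw [← this]
  simp

/-- Up to normalisation, the density of the logarithm of the random scale which represents the
`α`-Cauchy distribution as a scale mixture of Cauchy distributions. -/
noncomputable def logScaleDensity (α y : ℝ) : ℝ :=
  exp y * (exp (α * y) * sin (α * (π / 2))) /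
    ((1 + exp (α * y) * cos (α * (π / 2))) ^ 2 + (exp (α * y) * sin (α * (π / 2))) ^ 2)

theorem logScaleDensity_nonneg (hα : 1 < α) (hα₂ : α < 2) (y : ℝ) : 0 ≤ logScaleDensity α y := by
  have hπ := pi_pos
  have : 0 ≤ sin (α * (π / 2)) :=
    sin_nonneg_of_nonneg_of_le_pi (by positivity) (by nlinarith)
  unfold logScaleDensity
  positivity

theorem measurable_logScaleDensity : Measurable (logScaleDensity α) := by
  unfold logScaleDensity; fun_prop

theorem logIntegrand_re (x y : ℝ) :
    (logIntegrand α x y).re = exp y * (cos (x * exp y) * (1 + exp (α * y))⁻¹) := by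
  have h1 : Complex.exp (Complex.I * x * Complex.exp y) =
      (cos (x * exp y) : ℝ) + (sin (x * exp y) : ℝ) * Complex.I := by
    rw [mul_assoc, mul_comm, Complex.exp_mul_I]; push_cast; rfl
  have h2 : Complex.exp y / (1 + Complex.exp (α * y)) = (exp y / (1 + exp (α * y)) : ℝ) := by
    push_cast; rfl
  rw [logIntegrand, mul_div_assoc, h1, h2, Complex.re_mul_ofReal]
  generalize cos (x * exp y) = a, sin (x * exp y) = b
  simp only [Complex.add_re, Complex.ofReal_re, Complex.re_ofReal_mul, Complex.I_re, mul_zero,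
    add_zero]
  ring

theorem logIntegrand_add_pi_div_two_mul_I_re (x y : ℝ) :
    (logIntegrand α x (y + (π / 2 : ℝ) * Complex.I)).re =
      exp (-x * exp y) * logScaleDensity α y := by
  have h1 : Complex.exp (y + (π / 2 : ℝ) * Complex.I) = exp y * Complex.I := by
    rw [Complex.exp_add, Complex.exp_mul_I]; simp
  have h2 : Complex.exp (Complex.I * x * (exp y * Complex.I)) = (exp (-x * exp y) : ℝ) := by
    have : Complex.I * x * (exp y * Complex.I) = ((-x * exp y : ℝ) : ℂ) := by
      push_cast
      linear_combination (x : ℂ) * Complex.exp y * Complex.I_sq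
    rw [this, Complex.ofReal_exp]
  have h3 : Complex.exp (α * (y + (π / 2 : ℝ) * Complex.I)) =
      (exp (α * y) * cos (α * (π / 2)) : ℝ) +
        (exp (α * y) * sin (α * (π / 2)) : ℝ) * Complex.I := by
    rw [mul_add, Complex.exp_add, ← mul_assoc, Complex.exp_mul_I]
    push_cast
    ring
  rw [logIntegrand, h1, h2, h3, mul_div_assoc, Complex.re_ofReal_mul, logScaleDensity]
  congr 1
  generalize exp (α * y) * cos (α * (π / 2)) = a, exp (α * y) * sin (α * (π / 2)) = b,
    exp y = c
  rw [Complex.div_re, Complex.normSq_apply]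
  simp only [Complex.add_re, Complex.add_im, Complex.one_re, Complex.one_im, Complex.ofReal_re,
    Complex.ofReal_im, Complex.mul_re, Complex.mul_im, Complex.I_re, Complex.I_im]
  ring

theorem integrable_logScaleDensity (hα : 1 < α) (hα₂ : α < 2) :
    Integrable (logScaleDensity α) := by
  have h := (integrable_logIntegrand hα hα₂ le_rfl (φ := π / 2)
    ⟨by positivity, le_rfl⟩).re
  refine h.congr (.of_forall fun y => ?_)
  change (logIntegrand α 0 (y + (π / 2 : ℝ) * Complex.I)).re = _
  rw [logIntegrand_add_pi_div_two_mul_I_re]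
  simp

theorem integral_Ioi_cos_mul_inv_one_add_rpow (hα : 1 < α) (hα₂ : α < 2) {x : ℝ} (hx : 0 ≤ x) :
    ∫ t in Set.Ioi 0, cos (x * t) * (1 + t ^ α)⁻¹ =
      ∫ y, exp (-x * exp y) * logScaleDensity α y := by
  have hπ := pi_pos
  have hrot := congrArg Complex.re (integral_logIntegrand_eq hα hα₂ hx)
  have hi0 := integrable_logIntegrand hα hα₂ hx (φ := 0) ⟨le_rfl, by positivity⟩
  simp only [Complex.ofReal_zero, zero_mul, add_zero] at hi0
  have hi1 := integrable_logIntegrand hα hα₂ hx (φ := π / 2) ⟨by positivity, le_rfl⟩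
  have e0 := integral_re hi0
  have e1 := integral_re hi1
  simp only [RCLike.re_eq_complex_re] at e0 e1
  rw [← e0, ← e1] at hrot
  simp only [logIntegrand_re, logIntegrand_add_pi_div_two_mul_I_re] at hrot
  rw [← hrot, ← range_exp, ← Set.image_univ, integral_image_eq_integral_abs_deriv_smul
    MeasurableSet.univ (fun y _ => hasDerivWithinAt_exp_univ y) exp_injective.injOn,
    setIntegral_univ]
  refine integral_congr_ae (.of_forall fun y => ?_)
  simp only [smul_eq_mul, abs_exp]
  rw [← exp_mul, mul_comm y]

open ProbabilityTheory in
theorem isInfinitelyDivisible_alphaCauchy (hα : 1 < α) (hα₂ : α < 2) :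
    IsInfinitelyDivisible (alphaCauchy α) := by
  have hprob := isProbabilityMeasure_alphaCauchy hα
  have hc := alphaCauchyConst_pos hα
  set w : ℝ → ℝ := fun y => 2 * alphaCauchyConst α * logScaleDensity α y with hw
  have hw0 : ∀ y, 0 ≤ w y := fun y => by
    have := logScaleDensity_nonneg hα hα₂ y
    simp only [hw]
    positivity
  have hwm : Measurable w := measurable_logScaleDensity.const_mul _
  have hwi : Integrable w := (integrable_logScaleDensity hα hα₂).const_mul _
  have hchar : ∀ t, charFun (alphaCauchy α) t = (∫ y, exp (-|t| * exp y) * w y : ℝ) := by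
    intro t
    rw [charFun_alphaCauchy hα, integral_Ioi_cos_mul_inv_one_add_rpow hα hα₂ (abs_nonneg t),
      ← integral_const_mul]
    congr 2
    ext y
    simp only [hw]
    ring
  set P : Measure ℝ := volume.withDensity fun y => ENNReal.ofReal (w y) with hP
  have hPp : IsProbabilityMeasure P := by
    have h1 : ∫ y, w y = 1 := by
      have := hchar 0
      simp only [charFun_zero, probReal_univ, abs_zero, neg_zero, zero_mul, exp_zero,
        one_mul] at this
      exact_mod_cast this.symm
    refine ⟨?_⟩
    rw [hP, withDensity_apply _ MeasurableSet.univ, Measure.restrict_univ,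
      ← ofReal_integral_eq_lintegral_ofReal hwi (.of_forall hw0), h1, ENNReal.ofReal_one]
  refine isInfinitelyDivisible_of_charFun_eq_mgf (P := P) measurable_exp exp_pos fun t => ?_
  rw [hchar, mgf, hP, integral_withDensity_eq_integral_toReal_smul (by fun_prop) (by simp)]
  congr 2
  ext y
  rw [ENNReal.toReal_ofReal (hw0 y), smul_eq_mul, mul_comm]

end AlphaCauchy

theorem alphaCauchy_infinitelyDivisible (α : ℝ) (hα : 1 < α) (hα' : α ≤ 6 / 5) :
    IsInfinitelyDivisible (alphaCauchy α) :=
  isInfinitelyDivisible_alphaCauchy hα (by linarith)
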